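/- Let R = k[x_0,…,x_n] be a polynomial ring over a field k, let 𝔪 = (x_0,…,x_n), let I ⊆ R be a monomial ideal with big-height e whose minimal generators all have the same degree (I is equigenerated), and let 𝒬 be the symbolic polyhedron of I. If α(𝒬) ≥ (α(I) + e − 1)/e, then I^{(er)} ⊆ 𝔪^{(e−1)r} · I^r for all positive integers r. -/

import Mathlib

open MvPolynomial Pointwise

noncomputable section

/-- The contraction to `R` of the extension of `I ^ m` to the localization of `R` at the
prime ideal `P`, i.e. `R ∩ I^m R_P`. -/
def contractedPower {R : Type*} [CommRing R] (I : Ideal R) (m : ℕ)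
    (P : Ideal R) (hP : P.IsPrime) : Ideal R :=
  letI := hP
  (Ideal.map (algebraMap R (Localization.AtPrime P)) (I ^ m)).comap
    (algebraMap R (Localization.AtPrime P))

/-- `Q_{⊆ P} = R ∩ I R_P`, the contraction to `R` of the extension of `I` to `R_P`. -/
def Qsub {R : Type*} [CommRing R] (I P : Ideal R) (hP : P.IsPrime) : Ideal R :=
  letI := hP
  (Ideal.map (algebraMap R (Localization.AtPrime P)) I).comap
    (algebraMap R (Localization.AtPrime P))

/-- The `m`-th symbolic power `I^{(m)} = ⋂_{P ∈ Ass(I)} (R ∩ I^m R_P)`. -/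
def symbolicPower {R : Type*} [CommRing R] (I : Ideal R) (m : ℕ) : Ideal R :=
  ⨅ P : {P : Ideal R // P ∈ associatedPrimes R (R ⧸ I)},
    contractedPower I m P.1 P.2.isPrime

/-- The set of associated primes of `I` that are maximal with respect to inclusion. -/
def maxAss {R : Type*} [CommRing R] (I : Ideal R) : Set (Ideal R) :=
  {P | P ∈ associatedPrimes R (R ⧸ I) ∧
    ∀ P' ∈ associatedPrimes R (R ⧸ I), P ≤ P' → P = P'}

/-- A monomial ideal: an ideal generated by monomials. -/
def IsMonomialIdeal {k : Type*} [Field k] {n : ℕ}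
    (I : Ideal (MvPolynomial (Fin (n + 1)) k)) : Prop :=
  ∃ S : Set (Fin (n + 1) →₀ ℕ),
    I = Ideal.span ((fun a => (monomial a (1 : k) : MvPolynomial (Fin (n + 1)) k)) '' S)

/-- A square-free monomial ideal: an ideal generated by square-free monomials. -/
def IsSquarefreeMonomialIdeal {k : Type*} [Field k] {n : ℕ}
    (I : Ideal (MvPolynomial (Fin (n + 1)) k)) : Prop :=
  ∃ S : Set (Fin (n + 1) →₀ ℕ), (∀ a ∈ S, ∀ i, a i ≤ 1) ∧
    I = Ideal.span ((fun a => (monomial a (1 : k) : MvPolynomial (Fin (n + 1)) k)) '' S)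

/-- The height of a prime ideal. -/
def primeHeight {R : Type*} [CommRing R] (P : Ideal R) (hP : P.IsPrime) : ℕ∞ :=
  Order.height (⟨P, hP⟩ : PrimeSpectrum R)

/-- `e` is the big-height of `I`: the maximum of the heights of the associated primes of `I`. -/
def IsBigHeight {R : Type*} [CommRing R] (I : Ideal R) (e : ℕ) : Prop :=
  (∀ P, ∀ h : P ∈ associatedPrimes R (R ⧸ I), primeHeight P h.isPrime ≤ (e : ℕ∞)) ∧
    ∃ P, ∃ h : P ∈ associatedPrimes R (R ⧸ I), primeHeight P h.isPrime = (e : ℕ∞)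

/-- The irrelevant maximal ideal `𝔪 = (x_0, …, x_n)`. -/
def mId (k : Type*) [Field k] (n : ℕ) : Ideal (MvPolynomial (Fin (n + 1)) k) :=
  Ideal.span (Set.range X)

/-- The exponent vector of a monomial, viewed as a point of `ℝ^{n+1}`. -/
def expVec {n : ℕ} (a : Fin (n + 1) →₀ ℕ) : Fin (n + 1) → ℝ := fun i => (a i : ℝ)

/-- `L(J)`: the set of exponent vectors of the monomials lying in `J`. -/
def latticePoints {k : Type*} [Field k] {n : ℕ}
    (J : Ideal (MvPolynomial (Fin (n + 1)) k)) : Set (Fin (n + 1) → ℝ) :=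
  {v | ∃ a : Fin (n + 1) →₀ ℕ, monomial a (1 : k) ∈ J ∧ v = expVec a}

/-- The exponent vectors of the minimal monomial generators of a monomial ideal. -/
def minGens {k : Type*} [Field k] {n : ℕ}
    (J : Ideal (MvPolynomial (Fin (n + 1)) k)) : Set (Fin (n + 1) →₀ ℕ) :=
  {a | monomial a (1 : k) ∈ J ∧
    ∀ b : Fin (n + 1) →₀ ℕ, monomial b (1 : k) ∈ J → b ≤ a → b = a}

/-- The symbolic polyhedron `𝒬 = ⋂_{P ∈ maxAss(I)} conv(L(Q_{⊆P}))`. -/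
def symbolicPolyhedron {k : Type*} [Field k] {n : ℕ}
    (I : Ideal (MvPolynomial (Fin (n + 1)) k)) : Set (Fin (n + 1) → ℝ) :=
  ⋂ P : {P : Ideal (MvPolynomial (Fin (n + 1)) k) // P ∈ maxAss I},
    convexHull ℝ (latticePoints (Qsub I P.1 P.2.1.isPrime))

/-- `α(J)`: the least degree of a nonzero (homogeneous) element of `J`. -/
def alphaI {k : Type*} [Field k] {n : ℕ}
    (J : Ideal (MvPolynomial (Fin (n + 1)) k)) : ℕ :=
  sInf {d | ∃ f ∈ J, f ≠ 0 ∧ MvPolynomial.IsHomogeneous f d}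

/-- `β(J)`: the largest degree of a minimal generator of the monomial ideal `J`. -/
def betaI {k : Type*} [Field k] {n : ℕ}
    (J : Ideal (MvPolynomial (Fin (n + 1)) k)) : ℕ :=
  sSup {d | ∃ a ∈ minGens J, ∑ i, a i = d}

/-- `α(𝒫) = inf { a_0 + ⋯ + a_n : a ∈ 𝒫 }` for a subset `𝒫 ⊆ ℝ^{n+1}`. -/
def alphaSet {n : ℕ} (P : Set (Fin (n + 1) → ℝ)) : ℝ :=
  sInf ((fun v => ∑ i, v i) '' P)

/-- The set of all conical (nonnegative) combinations of elements of `S`. -/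
def conicalHull {E : Type*} [AddCommMonoid E] [Module ℝ E] (S : Set E) : Set E :=
  {x | ∃ (t : Finset E) (c : E → ℝ), ↑t ⊆ S ∧ (∀ y, 0 ≤ c y) ∧ x = ∑ y ∈ t, c y • y}

/-- The staircase of a monomial ideal `J`. -/
def stairs {k : Type*} [Field k] {n : ℕ}
    (J : Ideal (MvPolynomial (Fin (n + 1)) k)) : Set (Fin (n + 1) → ℝ) :=
  {v | (∀ i, 0 ≤ v i) ∧
    ∃ a : Fin (n + 1) →₀ ℕ, monomial a (1 : k) ∈ J ∧ ∀ i, (a i : ℝ) ≤ v i}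

end

/-- Conical Carathéodory with pigeonhole: a dominated nonnegative combination of nonnegative
vectors in dimension at most `e` with total weight at least `e * r` has a term whose vector,
scaled by `r`, is dominated as well. -/
theorem exists_mul_le_of_sum_mul_le {ι τ : Type*} [Fintype τ] (v : ι → τ → ℝ)
    (hv : ∀ i x, 0 ≤ v i x) (w : τ → ℝ) (hw : ∀ x, 0 ≤ w x) (e : ℕ) (he : 1 ≤ e)
    (hτ : Fintype.card τ ≤ e) (r : ℝ) (hr : 0 < r) (s : Finset ι) :
    ∀ c : ι → ℝ, (∀ i ∈ s, 0 ≤ c i) → e * r ≤ ∑ i ∈ s, c i →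
      (∀ x, ∑ i ∈ s, c i * v i x ≤ w x) → ∃ i ∈ s, ∀ x, r * v i x ≤ w x := by
  classical
  induction s using Finset.strongInduction with
  | H s ih =>
  intro c hc hsum hle
  have he' : (1 : ℝ) ≤ e := by exact_mod_cast he
  by_cases hbig : ∃ i ∈ s, r ≤ c i
  · obtain ⟨i, hi, hri⟩ := hbig
    refine ⟨i, hi, fun x => ?_⟩
    calc r * v i x ≤ c i * v i x := mul_le_mul_of_nonneg_right hri (hv i x)
      _ ≤ ∑ j ∈ s, c j * v j x :=
        Finset.single_le_sum (f := fun j => c j * v j x)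
          (fun j hj => mul_nonneg (hc j hj) (hv j x)) hi
      _ ≤ w x := hle x
  push Not at hbig
  have hne : s.Nonempty := by
    rw [Finset.nonempty_iff_ne_empty]
    rintro rfl
    simp only [Finset.sum_empty] at hsum
    nlinarith
  have hlt : ∑ i ∈ s, c i < s.card * r := by
    simpa using Finset.sum_lt_sum_of_nonempty hne hbig
  have hcard : e < s.card := by
    have : (e : ℝ) * r < s.card * r := hsum.trans_lt hlt
    exact_mod_cast lt_of_mul_lt_mul_right this hr.le
  have hdep : ¬ LinearIndependent ℝ (fun i : s => v i) := by
    intro h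
    have := h.fintype_card_le_finrank
    simp only [Fintype.card_coe, Module.finrank_fintype_fun_eq_card] at this
    omega
  obtain ⟨m, hm0, hm, hmpos⟩ : ∃ m : ι → ℝ, (∀ x, ∑ i ∈ s, m i * v i x = 0) ∧
      (∃ i ∈ s, m i ≠ 0) ∧ 0 ≤ ∑ i ∈ s, m i := by
    obtain ⟨g, hg, ⟨i, hi⟩, hgi⟩ := Fintype.not_linearIndependent_iff.mp hdep
    let m : ι → ℝ := fun j => if h : j ∈ s then g ⟨j, h⟩ else 0
    have hmx : ∀ x, ∑ j ∈ s, m j * v j x = 0 := fun x => by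
      have := congrFun hg x
      rw [← Finset.sum_coe_sort]
      simpa [m, Finset.sum_apply] using this
    have hmi : m i ≠ 0 := by simpa [m, hi] using hgi
    rcases le_total 0 (∑ j ∈ s, m j) with h | h
    · exact ⟨m, hmx, ⟨i, hi, hmi⟩, h⟩
    · refine ⟨fun j => - m j, fun x => ?_, ⟨i, hi, neg_ne_zero.mpr hmi⟩, ?_⟩
      · simp [hmx x]
      · simpa using h
  by_cases hneg : ∃ i ∈ s, m i < 0
  · obtain ⟨j, hj, hjmin⟩ := Finset.exists_min_image (s.filter fun i => m i < 0)
      (fun i => c i / (- m i)) (by simpa [Finset.Nonempty] using hneg)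
    simp only [Finset.mem_filter] at hj hjmin
    obtain ⟨hjs, hmj⟩ := hj
    set t := c j / (- m j) with ht
    have ht0 : 0 ≤ t := div_nonneg (hc j hjs) (by linarith)
    have hj0 : c j + t * m j = 0 := by
      rw [ht, div_neg, neg_mul, div_mul_cancel₀ _ hmj.ne, add_neg_cancel]
    obtain ⟨i, hi, h⟩ := ih (s.erase j) (Finset.erase_ssubset hjs) (fun i => c i + t * m i)
      (fun i hi => by
        have his := Finset.mem_of_mem_erase hi
        rcases lt_or_ge (m i) 0 with hmi | hmi
        · have := hjmin i ⟨his, hmi⟩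
          rw [le_div_iff₀ (by linarith)] at this
          linarith
        · have := hc i his
          positivity)
      (by
        rw [Finset.sum_erase s (f := fun i => c i + t * m i) hj0, Finset.sum_add_distrib, ← Finset.mul_sum]
        nlinarith [mul_nonneg ht0 hmpos])
      (fun x => by
        rw [Finset.sum_erase _ (by rw [hj0, zero_mul])]
        have : ∑ i ∈ s, (c i + t * m i) * v i x
            = ∑ i ∈ s, c i * v i x + t * ∑ i ∈ s, m i * v i x := by
          rw [Finset.mul_sum, ← Finset.sum_add_distrib]
          exact Finset.sum_congr rfl fun i _ => by ring
        rw [this, hm0 x]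
        simpa using hle x)
    exact ⟨i, Finset.mem_of_mem_erase hi, h⟩
  · push Not at hneg
    obtain ⟨i, hi, hmi⟩ := hm
    refine ⟨i, hi, fun x => ?_⟩
    have h1 := (Finset.sum_eq_zero_iff_of_nonneg
      (fun j hj => mul_nonneg (hneg j hj) (hv j x))).mp (hm0 x) i hi
    rw [(mul_eq_zero.mp h1).resolve_left hmi]
    simpa using hw x

section PrimeHeight

variable {k σ : Type*} [Field k]

open Classical in
/-- The substitution that sends the variables indexed by `s` to zero. -/
noncomputable def killVars (s : Finset σ) : MvPolynomial σ k →ₐ[k] MvPolynomial σ k :=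
  aeval fun i => if i ∈ s then 0 else X i

theorem ker_killVars_le (s : Finset σ) (P : Ideal (MvPolynomial σ k))
    (h : ∀ i ∈ s, X i ∈ P) : RingHom.ker (killVars (k := k) s) ≤ P := by
  classical
  have hcomp : (Ideal.Quotient.mkₐ k P).comp (killVars s) = Ideal.Quotient.mkₐ k P := by
    refine MvPolynomial.algHom_ext fun i => ?_
    by_cases hi : i ∈ s
    · have := Ideal.Quotient.eq_zero_iff_mem.mpr (h i hi)
      simp [killVars, hi, this]
    · simp [killVars, hi]
  intro f hf
  have := DFunLike.congr_fun hcomp f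
  rw [AlgHom.comp_apply, (RingHom.mem_ker).mp hf, map_zero] at this
  exact Ideal.Quotient.eq_zero_iff_mem.mp this.symm

theorem card_le_primeHeight (s : Finset σ) : ∀ (P : Ideal (MvPolynomial σ k)) (hP : P.IsPrime),
    (∀ i ∈ s, X i ∈ P) → (s.card : ℕ∞) ≤ primeHeight P hP := by
  classical
  induction s using Finset.induction_on with
  | empty => simp
  | insert i s his ih =>
    intro P hP h
    have hker : (RingHom.ker (killVars (k := k) s)).IsPrime := RingHom.ker_isPrime _
    have h1 := ih _ hker fun j hj => by simp [RingHom.mem_ker, killVars, hj]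
    have hlt : (⟨_, hker⟩ : PrimeSpectrum (MvPolynomial σ k)) < ⟨P, hP⟩ := by
      refine lt_of_le_of_ne
        (ker_killVars_le s P fun j hj => h j (Finset.mem_insert_of_mem hj)) fun heq => ?_
      have hXi : X i ∈ RingHom.ker (killVars (k := k) s) := by
        have hEq : RingHom.ker (killVars (k := k) s) = P := congrArg PrimeSpectrum.asIdeal heq
        rw [hEq]
        exact h i (Finset.mem_insert_self i s)
      simp [RingHom.mem_ker, killVars, his] at hXi
    rw [Finset.card_insert_of_notMem his]
    push_cast
    exact (add_le_add_left h1 1).trans (Order.height_add_one_le hlt)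

end PrimeHeight

section CommRing

variable {R : Type*} [CommRing R]

theorem mem_contractedPower {I : Ideal R} {m : ℕ} {P : Ideal R} (hP : P.IsPrime) {f : R} :
    f ∈ contractedPower I m P hP ↔ ∃ g ∉ P, g * f ∈ I ^ m := by
  rw [contractedPower, Ideal.mem_comap,
    IsLocalization.algebraMap_mem_map_algebraMap_iff P.primeCompl]
  rfl

theorem mem_Qsub {I P : Ideal R} (hP : P.IsPrime) {f : R} :
    f ∈ Qsub I P hP ↔ ∃ g ∉ P, g * f ∈ I := by
  rw [Qsub, Ideal.mem_comap, IsLocalization.algebraMap_mem_map_algebraMap_iff P.primeCompl]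
  rfl

theorem le_of_mem_associatedPrimes {I P : Ideal R} (h : P ∈ associatedPrimes R (R ⧸ I)) :
    I ≤ P := by
  have := IsAssociatedPrime.annihilator_le h
  rwa [Submodule.annihilator_top, Ideal.annihilator_quotient] at this

theorem mem_of_forall_associatedPrimes [IsNoetherianRing R] {I : Ideal R} {f : R}
    (h : ∀ P ∈ associatedPrimes R (R ⧸ I), ∃ g ∉ P, g * f ∈ I) : f ∈ I := by
  by_contra hf
  obtain ⟨P, hP, hle⟩ := exists_le_isAssociatedPrime_of_isNoetherianRing R
    (Ideal.Quotient.mk I f) (by rwa [Ne, Ideal.Quotient.eq_zero_iff_mem])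
  obtain ⟨g, hg, hgf⟩ := h P hP
  refine hg (hle ?_)
  rw [Submodule.mem_colon_singleton, Submodule.mem_bot, ← Ideal.Quotient.mk_eq_mk,
    ← Submodule.Quotient.mk_smul, Submodule.Quotient.mk_eq_zero]
  simpa using hgf

theorem exists_mem_maxAss [IsNoetherianRing R] {I : Ideal R}
    (h : (associatedPrimes R (R ⧸ I)).Nonempty) : ∃ P, P ∈ maxAss I := by
  obtain ⟨P, hP, hmax⟩ := set_has_maximal_iff_noetherian.mpr ‹IsNoetherianRing R›
    (associatedPrimes R (R ⧸ I)) h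
  exact ⟨P, hP, fun P' hP' hle => by
    by_contra hne
    exact hmax P' hP' (lt_of_le_of_ne hle hne)⟩

end CommRing

section MonomialIdeal

variable {k : Type*} [Field k] {n : ℕ} {I P : Ideal (MvPolynomial (Fin (n + 1)) k)}

theorem monomial_mem_of_le {a b : Fin (n + 1) →₀ ℕ} (h : a ≤ b)
    (ha : monomial a (1 : k) ∈ I) : monomial b (1 : k) ∈ I := by
  have : monomial b (1 : k) = monomial (b - a) 1 * monomial a 1 := by
    rw [monomial_mul, one_mul, tsub_add_cancel_of_le h]
  rw [this]
  exact I.mul_mem_left _ ha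

theorem mem_of_forall_monomial_mem {f : MvPolynomial (Fin (n + 1)) k}
    (h : ∀ a ∈ f.support, monomial a (1 : k) ∈ I) : f ∈ I := by
  rw [f.as_sum]
  refine I.sum_mem fun a ha => ?_
  rw [← mul_one (coeff a f), ← C_mul_monomial]
  exact I.mul_mem_left _ (h a ha)

theorem IsMonomialIdeal.monomial_mem (hI : IsMonomialIdeal I)
    {f : MvPolynomial (Fin (n + 1)) k} (hf : f ∈ I) {a : Fin (n + 1) →₀ ℕ}
    (ha : a ∈ f.support) : monomial a (1 : k) ∈ I := by
  obtain ⟨S, rfl⟩ := hI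
  obtain ⟨b, hb, hba⟩ := mem_ideal_span_monomial_image.mp hf a ha
  exact monomial_mem_of_le hba (Ideal.subset_span ⟨b, hb, rfl⟩)

theorem span_monomial_pow (S : Set (Fin (n + 1) →₀ ℕ)) (m : ℕ) :
    Ideal.span ((fun a => monomial a (1 : k)) '' S) ^ m =
      Ideal.span ((fun a => monomial a (1 : k)) '' (m • S)) := by
  induction m with
  | zero => simp [Ideal.one_eq_top]
  | succ m ih =>
    rw [pow_succ, ih, Ideal.span_mul_span', succ_nsmul]
    congr 1
    ext f
    simp only [Set.mem_mul, Set.mem_image, Set.mem_add]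
    constructor
    · rintro ⟨_, ⟨a, ha, rfl⟩, _, ⟨b, hb, rfl⟩, rfl⟩
      exact ⟨a + b, ⟨a, ha, b, hb, rfl⟩, by simp [monomial_mul]⟩
    · rintro ⟨_, ⟨a, ha, b, hb, rfl⟩, rfl⟩
      exact ⟨_, ⟨a, ha, rfl⟩, _, ⟨b, hb, rfl⟩, by simp [monomial_mul]⟩

theorem IsMonomialIdeal.pow (hI : IsMonomialIdeal I) (m : ℕ) : IsMonomialIdeal (I ^ m) := by
  obtain ⟨S, rfl⟩ := hI
  exact ⟨m • S, span_monomial_pow S m⟩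

theorem exists_minGens_le {a : Fin (n + 1) →₀ ℕ} (ha : monomial a (1 : k) ∈ I) :
    ∃ g ∈ minGens I, g ≤ a := by
  obtain ⟨g, hga, hg⟩ :=
    exists_minimal_le_of_wellFoundedLT (fun a => monomial a (1 : k) ∈ I) a ha
  exact ⟨g, ⟨hg.prop, fun b hb hbg => le_antisymm hbg (hg.le_of_le hb hbg)⟩, hga⟩

theorem IsMonomialIdeal.eq_span_minGens (hI : IsMonomialIdeal I) :
    I = Ideal.span ((fun a => monomial a (1 : k)) '' minGens I) := by
  refine le_antisymm (fun f hf => ?_) (Ideal.span_le.mpr ?_)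
  · exact mem_ideal_span_monomial_image.mpr fun a ha => exists_minGens_le (hI.monomial_mem hf ha)
  · rintro _ ⟨a, ha, rfl⟩
    exact ha.1

theorem IsMonomialIdeal.exists_sum_le (hI : IsMonomialIdeal I) {m : ℕ}
    {a : Fin (n + 1) →₀ ℕ} (ha : monomial a (1 : k) ∈ I ^ m) :
    ∃ g : Fin m → Fin (n + 1) →₀ ℕ, (∀ j, g j ∈ minGens I) ∧ ∑ j, g j ≤ a := by
  rw [hI.eq_span_minGens, span_monomial_pow] at ha
  obtain ⟨b, hb, hba⟩ := mem_ideal_span_monomial_image.mp ha a (by simp)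
  obtain ⟨g, rfl⟩ := Set.mem_nsmul.mp hb
  refine ⟨fun j => g j, fun j => (g j).2, ?_⟩
  rwa [← List.sum_ofFn]

theorem monomial_notMem_iff (hP : P.IsPrime) {a : Fin (n + 1) →₀ ℕ} :
    monomial a (1 : k) ∉ P ↔ ∀ i, X i ∈ P → a i = 0 := by
  constructor
  · intro h i hi
    by_contra hai
    refine h (monomial_mem_of_le (a := Finsupp.single i 1) ?_ hi)
    rw [Finsupp.single_le_iff]
    omega
  · intro h hmem
    rw [monomial_eq, C_1, one_mul, Finsupp.prod, hP.prod_mem_iff] at hmem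
    obtain ⟨i, hi, hmem⟩ := hmem
    exact Finsupp.mem_support_iff.mp hi (h i (hP.mem_of_pow_mem _ hmem))

theorem monomial_add_notMem (hP : P.IsPrime) {a b : Fin (n + 1) →₀ ℕ}
    (ha : monomial a (1 : k) ∉ P) (hb : monomial b (1 : k) ∉ P) :
    monomial (a + b) (1 : k) ∉ P := by
  rw [← one_mul (1 : k), ← monomial_mul]
  exact hP.mul_notMem ha hb

/-- If a monomial ideal is saturated by an element outside a prime `P`, then it is saturated, one
monomial at a time, by monomials outside `P`. -/
theorem IsMonomialIdeal.exists_monomial_add_mem (hI : IsMonomialIdeal I) (hP : P.IsPrime)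
    {f g : MvPolynomial (Fin (n + 1)) k} (hg : g ∉ P) (hgf : g * f ∈ I)
    {a : Fin (n + 1) →₀ ℕ} (ha : a ∈ f.support) :
    ∃ c, monomial c (1 : k) ∉ P ∧ monomial (c + a) (1 : k) ∈ I := by
  classical
  by_contra hbad
  let good : (Fin (n + 1) →₀ ℕ) → Prop := fun a =>
    ∃ c, monomial c (1 : k) ∉ P ∧ monomial (c + a) (1 : k) ∈ I
  let wt : (Fin (n + 1) →₀ ℕ) → ℕ := fun a => ∑ i with X i ∈ P, a i
  have hwt_add : ∀ a b, wt (a + b) = wt a + wt b := fun a b => by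
    simp [wt, Finset.sum_add_distrib]
  have hwt : ∀ a, monomial a (1 : k) ∉ P ↔ wt a = 0 := fun a => by
    rw [monomial_notMem_iff hP]
    simp [wt]
  obtain ⟨b, hb, hbmin⟩ := Finset.exists_min_image (f.support.filter fun a => ¬ good a) wt
    ⟨a, Finset.mem_filter.mpr ⟨ha, hbad⟩⟩
  have hA : (g.support.filter fun c => monomial c (1 : k) ∉ P).Nonempty := by
    by_contra hA
    refine hg (mem_of_forall_monomial_mem fun c hc => ?_)
    by_contra hcP
    exact hA ⟨c, Finset.mem_filter.mpr ⟨hc, hcP⟩⟩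
  have hB : ((f.support.filter fun a => ¬ good a).filter fun a => wt a = wt b).Nonempty :=
    ⟨b, Finset.mem_filter.mpr ⟨hb, rfl⟩⟩
  obtain ⟨c₀, hc₀, b₀, hb₀, huniq⟩ := UniqueSums.uniqueAdd_of_nonempty hA hB
  simp only [Finset.mem_filter] at hc₀ hb₀ hbmin
  obtain ⟨⟨hb₀f, hb₀bad⟩, hb₀wt⟩ := hb₀
  have huniq' : UniqueAdd g.support f.support c₀ b₀ := by
    intro c a hc ha hca
    have ha_bad : ¬ good a := by
      rintro ⟨d, hd, hda⟩
      refine hb₀bad ⟨d + c₀, monomial_add_notMem hP hd hc₀.2, ?_⟩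
      rw [add_assoc, ← hca]
      exact monomial_mem_of_le (add_le_add_right (le_add_of_nonneg_left zero_le) d) hda
    have h1 := congrArg wt hca
    rw [hwt_add, hwt_add, (hwt c₀).mp hc₀.2] at h1
    have h2 := hbmin a ⟨ha, ha_bad⟩
    refine huniq (Finset.mem_filter.mpr ⟨hc, (hwt c).mpr (by omega)⟩)
      (Finset.mem_filter.mpr ⟨Finset.mem_filter.mpr ⟨ha, ha_bad⟩, by omega⟩) hca
  have hcoeff : coeff (c₀ + b₀) (g * f) = coeff c₀ g * coeff b₀ f :=
    AddMonoidAlgebra.coeff_mul_add_of_uniqueAdd huniq'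
  refine hb₀bad ⟨c₀, hc₀.2, hI.monomial_mem hgf ?_⟩
  rw [mem_support_iff, hcoeff]
  exact mul_ne_zero (mem_support_iff.mp hc₀.1) (mem_support_iff.mp hb₀f)

theorem monomial_mem_mId_pow {a : Fin (n + 1) →₀ ℕ} {m : ℕ} (h : m ≤ ∑ i, a i) :
    monomial a (1 : k) ∈ mId k n ^ m := by
  refine Ideal.pow_le_pow_right h ?_
  rw [monomial_eq, C_1, one_mul, Finsupp.prod_fintype _ _ fun i => pow_zero _,
    ← Finset.prod_pow_eq_pow_sum]
  exact Ideal.prod_mem_prod fun i _ =>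
    Ideal.pow_mem_pow (Ideal.subset_span (Set.mem_range_self i)) _

theorem le_alphaI (hI : IsMonomialIdeal I) (hI0 : I ≠ ⊥) {d : ℕ}
    (hd : ∀ a ∈ minGens I, ∑ i, a i = d) : d ≤ alphaI I := by
  have key : ∀ a : Fin (n + 1) →₀ ℕ, monomial a (1 : k) ∈ I → d ≤ ∑ i, a i := fun a ha => by
    obtain ⟨g, hg, hga⟩ := exists_minGens_le ha
    rw [← hd g hg]
    exact Finset.sum_le_sum fun i _ => hga i
  refine le_csInf ?_ ?_
  · obtain ⟨f, hf, hf0⟩ := Submodule.exists_mem_ne_zero_of_ne_bot hI0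
    obtain ⟨a, ha⟩ := support_nonempty.mpr hf0
    exact ⟨a.degree, monomial a 1, hI.monomial_mem hf ha, by simp, isHomogeneous_monomial 1 rfl⟩
  · rintro m ⟨f, hf, hf0, hm⟩
    obtain ⟨a, ha⟩ := support_nonempty.mpr hf0
    have := key a (hI.monomial_mem hf ha)
    have hdeg : a.degree = m := by
      rw [Finsupp.degree_eq_weight_one]
      exact hm (mem_support_iff.mp ha)
    rwa [← Finsupp.degree_eq_sum, hdeg] at this

/-- Points of the symbolic polyhedron coming from monomials of a contracted power. -/
theorem smul_expVec_mem_convexHull (hI : IsMonomialIdeal I) (hP : P.IsPrime) {m : ℕ}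
    (hm : 0 < m) {a c : Fin (n + 1) →₀ ℕ} (hc : monomial c (1 : k) ∉ P)
    (hca : monomial (c + a) (1 : k) ∈ I ^ m) :
    (m : ℝ)⁻¹ • expVec a ∈ convexHull ℝ (latticePoints (Qsub I P hP)) := by
  classical
  obtain ⟨g, hg, hle⟩ := hI.exists_sum_le hca
  let u : Fin m → Fin (n + 1) →₀ ℕ := fun j => (g j).filter fun i => X i ∈ P
  have hu : ∑ j, u j ≤ a := fun i => by
    by_cases hi : X i ∈ P
    · have := hle i
      rw [Finsupp.add_apply, (monomial_notMem_iff hP).mp hc i hi] at this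
      simpa [u, hi, Finsupp.finsetSum_apply] using this
    · simp [u, hi, Finsupp.finsetSum_apply]
  have hmem : ∀ j (b : Fin (n + 1) →₀ ℕ), u j ≤ b → monomial b (1 : k) ∈ Qsub I P hP := by
    intro j b hb
    refine monomial_mem_of_le hb ((mem_Qsub hP).mpr
      ⟨monomial ((g j).filter fun i => ¬ X i ∈ P) 1, ?_, ?_⟩)
    · rw [monomial_notMem_iff hP]
      intro i hi
      simp [hi]
    · have hsplit : (g j).filter (fun i => ¬ X i ∈ P) + u j = g j := by
        rw [add_comm (Finsupp.filter _ _)]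
        exact Finsupp.filter_add_filter_not _ _
      rw [monomial_mul, one_mul, hsplit]
      exact (hg j).1
  let j₀ : Fin m := ⟨0, hm⟩
  let v : Fin m → Fin (n + 1) →₀ ℕ := fun j => u j + if j = j₀ then a - ∑ j, u j else 0
  have hv : ∑ j, v j = a := by
    simp only [v, Finset.sum_add_distrib, Finset.sum_ite_eq', Finset.mem_univ, if_true]
    exact add_tsub_cancel_of_le hu
  have hsum : (m : ℝ)⁻¹ • expVec a = ∑ j, (m : ℝ)⁻¹ • expVec (v j) := by
    rw [← Finset.smul_sum]
    congr 1
    ext i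
    rw [Finset.sum_apply]
    simp only [expVec]
    rw [← Nat.cast_sum, ← Finsupp.finsetSum_apply, hv]
  rw [hsum]
  refine (convex_convexHull ℝ _).sum_mem (fun j _ => by positivity) ?_
    fun j _ => subset_convexHull ℝ _ ⟨v j, hmem j _ le_self_add, rfl⟩
  have : (m : ℝ) ≠ 0 := by positivity
  simp [this]

theorem bddBelow_symbolicPolyhedron (h : ∃ P, P ∈ maxAss I) :
    BddBelow ((fun v => ∑ i, v i) '' symbolicPolyhedron I) := by
  obtain ⟨P, hP⟩ := h
  refine ⟨0, ?_⟩
  rintro _ ⟨v, hv, rfl⟩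
  have hsub : convexHull ℝ (latticePoints (Qsub I P hP.1.isPrime)) ⊆ Set.Ici 0 := by
    refine convexHull_min ?_ (convex_Ici 0)
    rintro _ ⟨a, -, rfl⟩ i
    exact Nat.cast_nonneg _
  exact Finset.sum_nonneg fun i _ => hsub (Set.mem_iInter.mp hv ⟨P, hP⟩) i

/-- Every exponent in an `e * r`-th power localized at a prime containing at most `e` variables
dominates, away from the inverted variables, `r` times the exponent of a minimal generator. -/
theorem IsMonomialIdeal.exists_minGens_mul_le (hI : IsMonomialIdeal I) (hP : P.IsPrime) {e r : ℕ}
    (he : 1 ≤ e) (hr : 1 ≤ r) (hPe : primeHeight P hP ≤ e) {a c : Fin (n + 1) →₀ ℕ}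
    (hc : monomial c (1 : k) ∉ P) (hca : monomial (c + a) (1 : k) ∈ I ^ (e * r)) :
    ∃ g ∈ minGens I, ∀ i, X i ∈ P → r * g i ≤ a i := by
  classical
  obtain ⟨g, hg, hle⟩ := hI.exists_sum_le hca
  have hcard : Fintype.card {i // (X i : MvPolynomial (Fin (n + 1)) k) ∈ P} ≤ e := by
    rw [Fintype.card_subtype]
    exact_mod_cast (card_le_primeHeight _ P hP fun i hi => (Finset.mem_filter.mp hi).2).trans hPe
  obtain ⟨j, -, hj⟩ := exists_mul_le_of_sum_mul_le
    (τ := {i // (X i : MvPolynomial (Fin (n + 1)) k) ∈ P})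
    (fun j i => ((g j i : ℕ) : ℝ)) (fun _ _ => Nat.cast_nonneg _) (fun i => (a i : ℝ))
    (fun _ => Nat.cast_nonneg _) e he hcard r (by exact_mod_cast hr) Finset.univ (fun _ => 1)
    (fun _ _ => zero_le_one) (by simp) (fun i => by
      have := hle i
      rw [Finsupp.add_apply, (monomial_notMem_iff hP).mp hc i i.2, zero_add,
        Finsupp.finsetSum_apply] at this
      simpa using (Nat.cast_le (α := ℝ)).mpr this)
  exact ⟨g j, hg j, fun i hi => by exact_mod_cast hj ⟨i, hi⟩⟩

end MonomialIdeal

theorem equigenerated_chudnovsky_implies_containment {k : Type*} [Field k] {n : ℕ}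
    (I : Ideal (MvPolynomial (Fin (n + 1)) k)) (hmon : IsMonomialIdeal I) (hI : I ≠ ⊥)
    (e : ℕ) (he : IsBigHeight I e)
    (hequi : ∃ d : ℕ, ∀ a ∈ minGens I, ∑ i, a i = d)
    (halpha : ((alphaI I : ℝ) + (e : ℝ) - 1) / (e : ℝ) ≤ alphaSet (symbolicPolyhedron I))
    (r : ℕ) (hr : 1 ≤ r) :
    symbolicPower I (e * r) ≤ mId k n ^ ((e - 1) * r) * I ^ r := by
  obtain ⟨d, hd⟩ := hequi
  have hdα := le_alphaI hmon hI hd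
  obtain ⟨hle, P₀, hP₀, hP₀e⟩ := he
  have he1 : 1 ≤ e := by
    obtain ⟨f, hf, hf0⟩ := Submodule.exists_mem_ne_zero_of_ne_bot hI
    obtain ⟨a, ha⟩ := support_nonempty.mpr hf0
    have haP := le_of_mem_associatedPrimes hP₀ (hmon.monomial_mem hf ha)
    by_contra he0
    refine (monomial_notMem_iff hP₀.isPrime).mpr (fun i hi => ?_) haP
    have := card_le_primeHeight {i} P₀ hP₀.isPrime (by simpa using hi)
    rw [hP₀e, Finset.card_singleton] at this
    exact absurd (by exact_mod_cast this) he0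
  intro f hf
  refine mem_of_forall_monomial_mem fun a ha => ?_
  have hloc : ∀ P, ∀ h : P ∈ associatedPrimes _ (_ ⧸ I),
      ∃ c, monomial c (1 : k) ∉ P ∧ monomial (c + a) (1 : k) ∈ I ^ (e * r) := fun P h => by
    obtain ⟨g, hg, hgf⟩ := (mem_contractedPower h.isPrime).mp ((Ideal.mem_iInf).mp hf ⟨P, h⟩)
    exact (hmon.pow _).exists_monomial_add_mem h.isPrime hg hgf ha
  have hfloor : monomial (a.mapRange (· / r) (Nat.zero_div r)) (1 : k) ∈ I := by
    refine mem_of_forall_associatedPrimes fun P h => ?_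
    obtain ⟨c, hc, hca⟩ := hloc P h
    obtain ⟨g, hg, hga⟩ := hmon.exists_minGens_mul_le h.isPrime he1 hr (hle P h) hc hca
    classical
    refine ⟨monomial (g.filter fun i => ¬ X i ∈ P) 1, ?_, ?_⟩
    · rw [monomial_notMem_iff h.isPrime]
      intro i hi
      simp [hi]
    · rw [monomial_mul, one_mul]
      refine monomial_mem_of_le (fun i => ?_) hg.1
      by_cases hi : X i ∈ P
      · simpa [hi] using (Nat.le_div_iff_mul_le hr).mpr ((mul_comm _ _).trans_le (hga i hi))
      · simp [hi]
  obtain ⟨g, hg, hga⟩ := exists_minGens_le hfloor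
  have hrg : r • g ≤ a := fun i => by
    have := hga i
    rw [Finsupp.mapRange_apply, Nat.le_div_iff_mul_le hr] at this
    simpa [mul_comm] using this
  have hdeg : r * (d + (e - 1)) ≤ ∑ i, a i := by
    have her : (0 : ℝ) < e * r := by exact_mod_cast Nat.mul_pos he1 hr
    have hmem : ((e * r : ℕ) : ℝ)⁻¹ • expVec a ∈ symbolicPolyhedron I := by
      refine Set.mem_iInter.mpr fun P => ?_
      obtain ⟨c, hc, hca⟩ := hloc P.1 P.2.1
      exact smul_expVec_mem_convexHull hmon _ (Nat.mul_pos he1 hr) hc hca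
    have h1 := halpha.trans
      (csInf_le (bddBelow_symbolicPolyhedron (exists_mem_maxAss ⟨P₀, hP₀⟩)) ⟨_, hmem, rfl⟩)
    have h2 : ∑ i, (((e * r : ℕ) : ℝ)⁻¹ • expVec a) i = ((∑ i, a i : ℕ) : ℝ) / (e * r) := by
      simp [expVec, ← Finset.mul_sum, div_eq_inv_mul]
    rw [show (fun v : Fin (n + 1) → ℝ => ∑ i, v i) (((e * r : ℕ) : ℝ)⁻¹ • expVec a) = _ from h2,
      div_le_div_iff₀ (by exact_mod_cast he1) her] at h1
    have he0 : (0 : ℝ) < e := by exact_mod_cast he1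
    have h3 : ((alphaI I : ℝ) + e - 1) * r ≤ ((∑ i, a i : ℕ) : ℝ) := by
      refine le_of_mul_le_mul_right ?_ he0
      linarith
    have h4 : ((r * (d + (e - 1)) : ℕ) : ℝ) ≤ ((alphaI I : ℝ) + e - 1) * r := by
      push_cast [Nat.cast_sub he1]
      have : (d : ℝ) ≤ alphaI I := by exact_mod_cast hdα
      nlinarith [(Nat.cast_nonneg r : (0 : ℝ) ≤ r)]
    exact_mod_cast h4.trans h3
  have hsplit : monomial a (1 : k) = monomial (a - r • g) 1 * monomial g 1 ^ r := by
    rw [monomial_pow, one_pow, monomial_mul, one_mul, tsub_add_cancel_of_le hrg]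
  rw [hsplit]
  refine Ideal.mul_mem_mul (monomial_mem_mId_pow ?_) (Ideal.pow_mem_pow hg.1 r)
  have hsum : ∑ i, (a - r • g) i + r * d = ∑ i, a i := by
    rw [← hd g hg, Finset.mul_sum, ← Finset.sum_add_distrib]
    refine Finset.sum_congr rfl fun i _ => ?_
    simpa using tsub_add_cancel_of_le (hrg i)
  have : (e - 1) * r = r * (e - 1) := mul_comm _ _
  rw [mul_add] at hdeg
  omega
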